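/- For every real λ > 1, every real γ with 0 < γ < 1, and every integer k ≥ 1, one has ∫_λ^∞ w^(k−γ) e^(−w) dw < e · k! · λ^(k−γ) · e^(−λ). -/

import Mathlib

open Real

/-- The primitive of `w ^ k * exp (-w)` that vanishes at infinity. -/
theorem hasDerivAt_neg_factorial_mul_sum_pow_div_factorial_mul_exp_neg (k : ℕ) (x : ℝ) :
    HasDerivAt (fun w : ℝ => -((k.factorial : ℝ) *
      ∑ j ∈ Finset.range (k + 1), w ^ j / (j.factorial : ℝ) * exp (-w)))
      (x ^ k * exp (-x)) x := by
  induction k with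
  | zero =>
    simpa using ((hasDerivAt_neg x).exp).fun_neg
  | succ k ih =>
    have hk : (k.factorial : ℝ) ≠ 0 := by positivity
    have hpow := ((hasDerivAt_pow (k + 1) x).mul ((hasDerivAt_neg x).exp)).neg
    refine ((ih.const_mul ((k : ℝ) + 1)).add hpow).congr_deriv ?_ |>.congr_of_eventuallyEq ?_
    · simp
      ring
    · refine Filter.Eventually.of_forall fun w => ?_
      simp only [Finset.sum_range_succ _ (k + 1), Nat.factorial_succ, Pi.add_apply, Pi.neg_apply,
        Pi.mul_apply]
      push_cast
      generalize ∑ j ∈ Finset.range (k + 1), w ^ j / (j.factorial : ℝ) * exp (-w) = s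
      generalize exp (-w) = e
      field_simp
      ring

theorem tendsto_neg_factorial_mul_sum_pow_div_factorial_mul_exp_neg (k : ℕ) :
    Filter.Tendsto (fun w : ℝ => -((k.factorial : ℝ) *
      ∑ j ∈ Finset.range (k + 1), w ^ j / (j.factorial : ℝ) * exp (-w)))
      Filter.atTop (nhds 0) := by
  have hsum : Filter.Tendsto (fun w : ℝ =>
      ∑ j ∈ Finset.range (k + 1), w ^ j / (j.factorial : ℝ) * exp (-w))
      Filter.atTop (nhds (∑ _j ∈ Finset.range (k + 1), (0 : ℝ))) := by
    refine tendsto_finsetSum _ fun j _ => ?_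
    have h := (tendsto_pow_mul_exp_neg_atTop_nhds_zero j).div_const (j.factorial : ℝ)
    rw [zero_div] at h
    exact h.congr fun w => by ring
  simpa using (hsum.const_mul (k.factorial : ℝ)).neg

theorem integrableOn_Ioi_pow_mul_exp_neg (k : ℕ) {a : ℝ} (ha : 0 ≤ a) :
    MeasureTheory.IntegrableOn (fun w : ℝ => w ^ k * exp (-w)) (Set.Ioi a) :=
  MeasureTheory.integrableOn_Ioi_deriv_of_nonneg'
    (fun x _ => hasDerivAt_neg_factorial_mul_sum_pow_div_factorial_mul_exp_neg k x)
    (fun x hx => by have : 0 < x := ha.trans_lt hx; positivity)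
    (tendsto_neg_factorial_mul_sum_pow_div_factorial_mul_exp_neg k)

/-- Closed form of the upper incomplete Gamma function at positive integers. -/
theorem integral_Ioi_pow_mul_exp_neg (k : ℕ) {a : ℝ} (ha : 0 ≤ a) :
    ∫ w in Set.Ioi a, w ^ k * exp (-w) =
      (k.factorial : ℝ) * ∑ j ∈ Finset.range (k + 1), a ^ j / (j.factorial : ℝ) * exp (-a) := by
  rw [MeasureTheory.integral_Ioi_of_hasDerivAt_of_nonneg'
    (fun x _ => hasDerivAt_neg_factorial_mul_sum_pow_div_factorial_mul_exp_neg k x)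
    (fun x hx => by have : 0 < x := ha.trans_lt hx; positivity)
    (tendsto_neg_factorial_mul_sum_pow_div_factorial_mul_exp_neg k)]
  ring

theorem sum_range_one_div_factorial_lt_exp_one (n : ℕ) :
    ∑ j ∈ Finset.range n, 1 / (j.factorial : ℝ) < exp 1 := by
  have h := sum_le_exp_of_nonneg zero_le_one (n + 1)
  simp only [one_pow, Finset.sum_range_succ _ n] at h
  have : 0 < 1 / (n.factorial : ℝ) := by positivity
  linarith

/-- Gamma-tail estimate: `∫_λ^∞ w^(k-γ) e^(-w) dw < e · k! · λ^(k-γ) · e^(-λ)`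
for `λ > 1`, `0 < γ < 1`, `k ≥ 1`. -/
theorem gamma_tail_estimate (lam : ℝ) (hlam : 1 < lam) (γ : ℝ) (hγ0 : 0 < γ) (hγ1 : γ < 1)
    (k : ℕ) (hk : 1 ≤ k) :
    (∫ w in Set.Ioi lam, w ^ ((k : ℝ) - γ) * Real.exp (-w)) <
      Real.exp 1 * (k.factorial : ℝ) * lam ^ ((k : ℝ) - γ) * Real.exp (-lam) := by
  have hpos : 0 < lam := by linarith
  have hsplit : ∀ w : ℝ, 0 < w → w ^ ((k : ℝ) - γ) = w ^ (-γ) * w ^ k := fun w hw => by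
    rw [sub_eq_neg_add, rpow_add hw, rpow_natCast]
  calc ∫ w in Set.Ioi lam, w ^ ((k : ℝ) - γ) * exp (-w)
      ≤ ∫ w in Set.Ioi lam, lam ^ (-γ) * (w ^ k * exp (-w)) := by
        refine MeasureTheory.integral_mono_of_nonneg ?_
          ((integrableOn_Ioi_pow_mul_exp_neg k hpos.le).const_mul _) ?_
        · filter_upwards [MeasureTheory.ae_restrict_mem measurableSet_Ioi] with w hw
          have : 0 < w := hpos.trans hw
          simp only [Pi.zero_apply]
          positivity
        · filter_upwards [MeasureTheory.ae_restrict_mem measurableSet_Ioi] with w hw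
          have hw0 : 0 < w := hpos.trans hw
          have hle : w ^ (-γ) ≤ lam ^ (-γ) :=
            rpow_le_rpow_of_nonpos hpos (le_of_lt hw) (by linarith)
          simp only [hsplit w hw0, mul_assoc]
          gcongr
    _ = lam ^ (-γ) * ((k.factorial : ℝ) *
          ∑ j ∈ Finset.range (k + 1), lam ^ j / (j.factorial : ℝ) * exp (-lam)) := by
        rw [MeasureTheory.integral_const_mul, integral_Ioi_pow_mul_exp_neg k hpos.le]
    _ ≤ lam ^ (-γ) * ((k.factorial : ℝ) *
          ∑ j ∈ Finset.range (k + 1), lam ^ k / (j.factorial : ℝ) * exp (-lam)) := by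
        gcongr with j hj
        · exact hlam.le
        · exact Nat.lt_succ_iff.mp (Finset.mem_range.mp hj)
    _ = (∑ j ∈ Finset.range (k + 1), 1 / (j.factorial : ℝ)) *
          ((k.factorial : ℝ) * lam ^ ((k : ℝ) - γ) * exp (-lam)) := by
        rw [hsplit lam hpos, Finset.mul_sum, Finset.mul_sum, Finset.sum_mul]
        exact Finset.sum_congr rfl fun j _ => by ring
    _ < exp 1 * ((k.factorial : ℝ) * lam ^ ((k : ℝ) - γ) * exp (-lam)) := by
        gcongr
        exact sum_range_one_div_factorial_lt_exp_one (k + 1)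
    _ = exp 1 * (k.factorial : ℝ) * lam ^ ((k : ℝ) - γ) * exp (-lam) := by ring
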